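/- arXiv:1012.2630 — 2 statements merged into one kernel-verified Lean document; each statement's English description precedes it below -/
import Mathlib

section
/- Let d ≥ 4 and let v : Fin 2 → Fin 2 → Fin d → ℝ. Then the invariant tuple (n₁(v), n₂(v), n₃(v), ñ₄(v)) is one of the following ten tuples: (2, 2, d, 4d), (1, 1, d−1, 3d−2), (0, 0, d−1, 3d−3), (0, 1, d−2, 2d−1), (1, 0, d−2, 2d−1), (0, 0, d−2, 2d−3), (0, 0, d−2, 2d−4), (0, 0, d−3, d−2), (0, 0, d−3, d−3), (0, 0, d−4, 0). (Completeness of the entanglement classification for three subsystems of dimensions (2, 2, d) with d ≥ 4: there are exactly 10 classes.) -/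
variable {d₁ d₂ d₃ : ℕ}

/-- Solution space `{w | ∀ j₂ j₃, ∑ j₁, v j₁ j₂ j₃ * w j₁ = 0}`. -/
def S₁ (v : Fin d₁ → Fin d₂ → Fin d₃ → ℝ) : Submodule ℝ (Fin d₁ → ℝ) where
  carrier := { w | ∀ j₂ j₃, ∑ j₁, v j₁ j₂ j₃ * w j₁ = 0 }
  zero_mem' := by intro j₂ j₃; simp
  add_mem' := by
    intro a b ha hb j₂ j₃
    simp only [Pi.add_apply, mul_add, Finset.sum_add_distrib]
    rw [ha j₂ j₃, hb j₂ j₃, add_zero]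
  smul_mem' := by
    intro c a ha j₂ j₃
    have hc : ∀ x y : ℝ, x * (c * y) = c * (x * y) := fun x y => mul_left_comm x c y
    simp only [Pi.smul_apply, smul_eq_mul, hc, ← Finset.mul_sum]
    rw [ha j₂ j₃, mul_zero]

/-- Solution space `{w | ∀ j₁ j₃, ∑ j₂, v j₁ j₂ j₃ * w j₂ = 0}`. -/
def S₂ (v : Fin d₁ → Fin d₂ → Fin d₃ → ℝ) : Submodule ℝ (Fin d₂ → ℝ) where
  carrier := { w | ∀ j₁ j₃, ∑ j₂, v j₁ j₂ j₃ * w j₂ = 0 }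
  zero_mem' := by intro j₁ j₃; simp
  add_mem' := by
    intro a b ha hb j₁ j₃
    simp only [Pi.add_apply, mul_add, Finset.sum_add_distrib]
    rw [ha j₁ j₃, hb j₁ j₃, add_zero]
  smul_mem' := by
    intro c a ha j₁ j₃
    have hc : ∀ x y : ℝ, x * (c * y) = c * (x * y) := fun x y => mul_left_comm x c y
    simp only [Pi.smul_apply, smul_eq_mul, hc, ← Finset.mul_sum]
    rw [ha j₁ j₃, mul_zero]

/-- Solution space `{w | ∀ j₁ j₂, ∑ j₃, v j₁ j₂ j₃ * w j₃ = 0}`. -/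
def S₃ (v : Fin d₁ → Fin d₂ → Fin d₃ → ℝ) : Submodule ℝ (Fin d₃ → ℝ) where
  carrier := { w | ∀ j₁ j₂, ∑ j₃, v j₁ j₂ j₃ * w j₃ = 0 }
  zero_mem' := by intro j₁ j₂; simp
  add_mem' := by
    intro a b ha hb j₁ j₂
    simp only [Pi.add_apply, mul_add, Finset.sum_add_distrib]
    rw [ha j₁ j₂, hb j₁ j₂, add_zero]
  smul_mem' := by
    intro c a ha j₁ j₂
    have hc : ∀ x y : ℝ, x * (c * y) = c * (x * y) := fun x y => mul_left_comm x c y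
    simp only [Pi.smul_apply, smul_eq_mul, hc, ← Finset.mul_sum]
    rw [ha j₁ j₂, mul_zero]

/-- Solution space of the three simultaneous pairwise contraction conditions
defining the intersection invariant `ñ₄`. -/
def S₄ (v : Fin d₁ → Fin d₂ → Fin d₃ → ℝ) :
    Submodule ℝ (Fin d₁ → Fin d₂ → Fin d₃ → ℝ) where
  carrier := { w |
    (∀ j₃ k₃, ∑ j₁, ∑ j₂, v j₁ j₂ j₃ * w j₁ j₂ k₃ = 0) ∧
    (∀ j₂ k₂, ∑ j₁, ∑ j₃, v j₁ j₂ j₃ * w j₁ k₂ j₃ = 0) ∧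
    (∀ j₁ k₁, ∑ j₂, ∑ j₃, v j₁ j₂ j₃ * w k₁ j₂ j₃ = 0) }
  zero_mem' := by
    refine ⟨?_, ?_, ?_⟩ <;> intro a b <;> simp
  add_mem' := by
    rintro a b ⟨ha1, ha2, ha3⟩ ⟨hb1, hb2, hb3⟩
    refine ⟨fun p q => ?_, fun p q => ?_, fun p q => ?_⟩ <;>
      simp only [Pi.add_apply, mul_add, Finset.sum_add_distrib]
    · rw [ha1 p q, hb1 p q, add_zero]
    · rw [ha2 p q, hb2 p q, add_zero]
    · rw [ha3 p q, hb3 p q, add_zero]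
  smul_mem' := by
    rintro c a ⟨ha1, ha2, ha3⟩
    have hc : ∀ x y : ℝ, x * (c * y) = c * (x * y) := fun x y => mul_left_comm x c y
    refine ⟨fun p q => ?_, fun p q => ?_, fun p q => ?_⟩ <;>
      simp only [Pi.smul_apply, smul_eq_mul, hc, ← Finset.mul_sum]
    · rw [ha1 p q, mul_zero]
    · rw [ha2 p q, mul_zero]
    · rw [ha3 p q, mul_zero]

/-- `n₁(v)`: the dimension of `S₁ v`. -/
noncomputable def n₁ (v : Fin d₁ → Fin d₂ → Fin d₃ → ℝ) : ℕ :=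
  Module.finrank ℝ (S₁ v)

/-- `n₂(v)`: the dimension of `S₂ v`. -/
noncomputable def n₂ (v : Fin d₁ → Fin d₂ → Fin d₃ → ℝ) : ℕ :=
  Module.finrank ℝ (S₂ v)

/-- `n₃(v)`: the dimension of `S₃ v`. -/
noncomputable def n₃ (v : Fin d₁ → Fin d₂ → Fin d₃ → ℝ) : ℕ :=
  Module.finrank ℝ (S₃ v)

/-- `ñ₄(v)`: the dimension of `S₄ v`. -/
noncomputable def n₄ (v : Fin d₁ → Fin d₂ → Fin d₃ → ℝ) : ℕ :=
  Module.finrank ℝ (S₄ v)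

open Module Matrix

/-- The Frobenius bilinear form `(e, f) ↦ tr (eᵀ f)` on real `2 × 2` matrices. -/
noncomputable def frobForm : LinearMap.BilinForm ℝ (Matrix (Fin 2) (Fin 2) ℝ) :=
  LinearMap.mk₂ ℝ (fun e f => (eᵀ * f).trace)
    (by intros; simp [add_mul]) (by intros; simp)
    (by intros; simp [mul_add]) (by intros; simp)

/-- The bilinear map `(e, f) ↦ (eᵀ f, e fᵀ)` collecting the two single-index contractions. -/
noncomputable def contraction : Matrix (Fin 2) (Fin 2) ℝ →ₗ[ℝ] Matrix (Fin 2) (Fin 2) ℝ →ₗ[ℝ]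
    Matrix (Fin 2) (Fin 2) ℝ × Matrix (Fin 2) (Fin 2) ℝ :=
  LinearMap.mk₂ ℝ (fun e f => (eᵀ * f, e * fᵀ))
    (by intros; simp [add_mul]) (by intros; simp)
    (by intros; simp [mul_add]) (by intros; simp)

lemma frobForm_apply (e f : Matrix (Fin 2) (Fin 2) ℝ) : frobForm e f = (eᵀ * f).trace := rfl

lemma contraction_apply (e f : Matrix (Fin 2) (Fin 2) ℝ) :
    contraction e f = (eᵀ * f, e * fᵀ) := rfl

lemma frobForm_eq_sum (e f : Matrix (Fin 2) (Fin 2) ℝ) :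
    frobForm e f = e 0 0 * f 0 0 + e 0 1 * f 0 1 + e 1 0 * f 1 0 + e 1 1 * f 1 1 := by
  simp [frobForm_apply, Matrix.trace, Matrix.mul_apply, Fin.sum_univ_two]
  ring

lemma frobForm_isRefl : frobForm.IsRefl := by
  intro e f h
  rw [frobForm_eq_sum] at h ⊢
  linarith

lemma frobForm_nondegenerate : frobForm.Nondegenerate := by
  have key : ∀ e : Matrix (Fin 2) (Fin 2) ℝ, frobForm e e = 0 → e = 0 := by
    intro e h
    rw [frobForm_eq_sum] at h
    ext i j
    fin_cases i <;> fin_cases j <;> simp <;>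
      nlinarith [sq_nonneg (e 0 0), sq_nonneg (e 0 1), sq_nonneg (e 1 0), sq_nonneg (e 1 1)]
  exact ⟨fun e h => key e (h e), fun e h => key e (h e)⟩

/-- The span of the contractions `(eᵀ f, e fᵀ)` with `e ∈ W` and `f ∈ Wᗮ`. -/
noncomputable def contractionSpan (W : Submodule ℝ (Matrix (Fin 2) (Fin 2) ℝ)) :
    Submodule ℝ (Matrix (Fin 2) (Fin 2) ℝ × Matrix (Fin 2) (Fin 2) ℝ) :=
  Submodule.map₂ contraction W (frobForm.orthogonal W)

lemma finrank_orthogonal_frobForm (W : Submodule ℝ (Matrix (Fin 2) (Fin 2) ℝ)) :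
    finrank ℝ (frobForm.orthogonal W) = 4 - finrank ℝ W := by
  rw [LinearMap.BilinForm.finrank_orthogonal frobForm_nondegenerate]
  simp [Module.finrank_matrix]

/-- The linear map `w ↦ ∑ k, (E kᵀ w k, E k w kᵀ)` on families with values in `F`. -/
noncomputable def totalContraction {ι : Type*} [Fintype ι] (E : ι → Matrix (Fin 2) (Fin 2) ℝ)
    (F : Submodule ℝ (Matrix (Fin 2) (Fin 2) ℝ)) :
    (ι → F) →ₗ[ℝ] Matrix (Fin 2) (Fin 2) ℝ × Matrix (Fin 2) (Fin 2) ℝ :=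
  ∑ k, (contraction (E k) ∘ₗ F.subtype) ∘ₗ LinearMap.proj k

lemma totalContraction_apply {ι : Type*} [Fintype ι] (E : ι → Matrix (Fin 2) (Fin 2) ℝ)
    (F : Submodule ℝ (Matrix (Fin 2) (Fin 2) ℝ)) (w : ι → F) :
    totalContraction E F w = ∑ k, contraction (E k) (w k) := by
  simp [totalContraction]

lemma range_totalContraction {ι : Type*} [Fintype ι] (E : ι → Matrix (Fin 2) (Fin 2) ℝ)
    (F : Submodule ℝ (Matrix (Fin 2) (Fin 2) ℝ)) :
    (totalContraction E F).range =
      Submodule.map₂ contraction (Submodule.span ℝ (Set.range E)) F := by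
  classical
  apply le_antisymm
  · rintro _ ⟨w, rfl⟩
    rw [totalContraction_apply]
    exact Submodule.sum_mem _ fun k _ => Submodule.apply_mem_map₂ _
      (Submodule.subset_span ⟨k, rfl⟩) (w k).2
  · rw [Submodule.map₂_le]
    intro e he f hf
    induction he using Submodule.span_induction with
    | mem x hx =>
      obtain ⟨k, rfl⟩ := hx
      refine ⟨Pi.single k ⟨f, hf⟩, ?_⟩
      rw [totalContraction_apply, Finset.sum_eq_single k]
      · simp
      · intro b _ hb
        simp [Pi.single_eq_of_ne hb]
      · simp
    | zero => simp
    | add x y _ _ hx hy => simpa using Submodule.add_mem _ hx hy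
    | smul a x _ hx => simpa using Submodule.smul_mem _ a hx

lemma finrank_map₂_contraction_add_finrank_ker {ι : Type*} [Fintype ι]
    (E : ι → Matrix (Fin 2) (Fin 2) ℝ) (F : Submodule ℝ (Matrix (Fin 2) (Fin 2) ℝ)) :
    finrank ℝ (Submodule.map₂ contraction (Submodule.span ℝ (Set.range E)) F) +
      finrank ℝ (totalContraction E F).ker = Fintype.card ι * finrank ℝ F := by
  rw [← range_totalContraction, LinearMap.finrank_range_add_finrank_ker, Module.finrank_pi_fintype]
  simp

lemma finrank_map₂_contraction_comm (W F : Submodule ℝ (Matrix (Fin 2) (Fin 2) ℝ)) :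
    finrank ℝ (Submodule.map₂ contraction W F) = finrank ℝ (Submodule.map₂ contraction F W) := by
  let T := (Matrix.transposeLinearEquiv (Fin 2) (Fin 2) ℝ ℝ).prodCongr
    (Matrix.transposeLinearEquiv (Fin 2) (Fin 2) ℝ ℝ)
  have h : contraction.flip = contraction.compr₂ T.toLinearMap := by
    ext1 e; ext1 f; simp [T, contraction_apply]
  rw [← Submodule.map₂_flip, h, ← Submodule.map_map₂]
  exact LinearEquiv.finrank_map_eq T _

lemma finrank_contractionSpan_orthogonal (W : Submodule ℝ (Matrix (Fin 2) (Fin 2) ℝ)) :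
    finrank ℝ (contractionSpan (frobForm.orthogonal W)) = finrank ℝ (contractionSpan W) := by
  rw [contractionSpan, contractionSpan, LinearMap.BilinForm.orthogonal_orthogonal
    frobForm_nondegenerate frobForm_isRefl, finrank_map₂_contraction_comm]

/-- The `k`-th slice `v · · k` as a matrix. -/
def slice {d : ℕ} (v : Fin 2 → Fin 2 → Fin d → ℝ) (k : Fin d) : Matrix (Fin 2) (Fin 2) ℝ :=
  Matrix.of fun i j => v i j k

/-- The span of all slices `v · · k`. -/
def sliceSpan {d : ℕ} (v : Fin 2 → Fin 2 → Fin d → ℝ) :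
    Submodule ℝ (Matrix (Fin 2) (Fin 2) ℝ) :=
  Submodule.span ℝ (Set.range (slice v))

lemma finrank_sliceSpan_add_n₃ {d : ℕ} (v : Fin 2 → Fin 2 → Fin d → ℝ) :
    finrank ℝ (sliceSpan v) + n₃ v = d := by
  have hker : S₃ v = (Fintype.linearCombination ℝ (slice v)).ker := by
    ext w
    have : w ∈ S₃ v ↔ ∀ i j, ∑ k, v i j k * w k = 0 := Iff.rfl
    rw [this, LinearMap.mem_ker, Fintype.linearCombination_apply, ← Matrix.ext_iff]
    simp [Matrix.sum_apply, slice, mul_comm]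
  rw [n₃, hker, sliceSpan, ← Fintype.range_linearCombination,
    LinearMap.finrank_range_add_finrank_ker]
  simp

lemma mem_orthogonal_sliceSpan {d : ℕ} (v : Fin 2 → Fin 2 → Fin d → ℝ)
    (f : Matrix (Fin 2) (Fin 2) ℝ) :
    f ∈ frobForm.orthogonal (sliceSpan v) ↔ ∀ k, frobForm (slice v k) f = 0 := by
  constructor
  · exact fun h k => h _ (Submodule.subset_span ⟨k, rfl⟩)
  · intro h e he
    induction he using Submodule.span_induction with
    | mem x hx => obtain ⟨k, rfl⟩ := hx; exact h k
    | zero => simp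
    | add x y _ _ hx hy => simp [hx, hy]
    | smul a x _ hx => simp [hx]

lemma mem_S₄_iff {d : ℕ} (v w : Fin 2 → Fin 2 → Fin d → ℝ) :
    w ∈ S₄ v ↔ (∀ k, slice w k ∈ frobForm.orthogonal (sliceSpan v)) ∧
      ∑ k, contraction (slice v k) (slice w k) = 0 := by
  have h : w ∈ S₄ v ↔ (∀ j₃ k₃, ∑ j₁, ∑ j₂, v j₁ j₂ j₃ * w j₁ j₂ k₃ = 0) ∧
    (∀ j₂ k₂, ∑ j₁, ∑ j₃, v j₁ j₂ j₃ * w j₁ k₂ j₃ = 0) ∧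
    (∀ j₁ k₁, ∑ j₂, ∑ j₃, v j₁ j₂ j₃ * w k₁ j₂ j₃ = 0) := Iff.rfl
  rw [h]
  refine and_congr ?_ ?_
  · simp only [mem_orthogonal_sliceSpan, frobForm_eq_sum, slice, Matrix.of_apply,
      Fin.sum_univ_two, ← add_assoc]
    exact forall_comm
  · rw [Prod.ext_iff, Prod.fst_sum, Prod.snd_sum, ← Matrix.ext_iff, ← Matrix.ext_iff]
    simp only [contraction_apply, Matrix.sum_apply, Matrix.mul_apply, Matrix.transpose_apply, slice,
      Matrix.of_apply, Fin.sum_univ_two, Finset.sum_add_distrib, Prod.fst_zero, Prod.snd_zero,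
      Matrix.zero_apply]

/-- `S₄ v` is the kernel of the total contraction with the slices of `v`. -/
noncomputable def S₄Equiv {d : ℕ} (v : Fin 2 → Fin 2 → Fin d → ℝ) :
    S₄ v ≃ₗ[ℝ] (totalContraction (slice v) (frobForm.orthogonal (sliceSpan v))).ker where
  toFun w := ⟨fun k => ⟨slice w.1 k, ((mem_S₄_iff v w).1 w.2).1 k⟩, by
    rw [LinearMap.mem_ker, totalContraction_apply]
    exact ((mem_S₄_iff v w).1 w.2).2⟩
  invFun w := ⟨fun i j k => (w.1 k).1 i j, by
    have := w.2
    rw [LinearMap.mem_ker, totalContraction_apply] at this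
    exact (mem_S₄_iff v _).2 ⟨fun k => (w.1 k).2, this⟩⟩
  map_add' _ _ := rfl
  map_smul' _ _ := rfl

lemma finrank_contractionSpan_add_n₄ {d : ℕ} (v : Fin 2 → Fin 2 → Fin d → ℝ) :
    finrank ℝ (contractionSpan (sliceSpan v)) + n₄ v = d * (4 - finrank ℝ (sliceSpan v)) := by
  rw [n₄, (S₄Equiv v).finrank_eq, ← finrank_orthogonal_frobForm]
  have h := finrank_map₂_contraction_add_finrank_ker (slice v) (frobForm.orthogonal (sliceSpan v))
  rwa [Fintype.card_fin] at h

lemma finrank_le_one_of_functional {V : Type*} [AddCommGroup V] [Module ℝ V] (K : Submodule ℝ V)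
    (φ : V →ₗ[ℝ] ℝ) (h : ∀ x ∈ K, φ x = 0 → x = 0) : finrank ℝ K ≤ 1 := by
  have hinj : Function.Injective (φ.domRestrict K) := by
    rw [← LinearMap.ker_eq_bot, LinearMap.ker_eq_bot']
    exact fun x hx => Subtype.ext (h x x.2 hx)
  simpa using LinearMap.finrank_le_finrank_of_injective hinj

lemma finrank_ker_contraction_le_one {m : Matrix (Fin 2) (Fin 2) ℝ} (hm : m ≠ 0) :
    finrank ℝ (contraction m).ker ≤ 1 := by
  obtain ⟨i, j, hij⟩ : ∃ i j, m i j ≠ 0 := by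
    by_contra! h
    exact hm (Matrix.ext h)
  refine finrank_le_one_of_functional _
    (LinearMap.proj (i + 1) ∘ₗ LinearMap.proj (j + 1) ∘ₗ
      (Matrix.transposeLinearEquiv (Fin 2) (Fin 2) ℝ ℝ).toLinearMap) fun f hf hφ => ?_
  have hφ' : f (i + 1) (j + 1) = 0 := hφ
  rw [LinearMap.mem_ker, contraction_apply, Prod.ext_iff, ← Matrix.ext_iff, ← Matrix.ext_iff] at hf
  simp only [Fin.forall_fin_two, Matrix.mul_apply, Fin.sum_univ_two, Matrix.transpose_apply,
    Prod.fst_zero, Prod.snd_zero, Matrix.zero_apply] at hf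
  rw [← Matrix.ext_iff]
  simp only [Fin.forall_fin_two, Matrix.zero_apply]
  fin_cases i <;> fin_cases j <;> simp at hij hφ' <;> grind

lemma ker_contraction_eq_bot {m : Matrix (Fin 2) (Fin 2) ℝ} (hm : m.det ≠ 0) :
    (contraction m).ker = ⊥ := by
  rw [LinearMap.ker_eq_bot']
  intro f hf
  have h : mᵀ * f = 0 := congrArg Prod.fst hf
  have hu : IsUnit mᵀ := (Matrix.isUnit_iff_isUnit_det _).2 (by simpa using hm)
  exact hu.mul_right_eq_zero.1 h

lemma ker_contraction_ne_bot {m : Matrix (Fin 2) (Fin 2) ℝ} (h0 : m ≠ 0) (hm : m.det = 0) :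
    (contraction m).ker ≠ ⊥ := by
  intro h
  have hadj : m.adjugateᵀ ∈ (contraction m).ker := by
    rw [LinearMap.mem_ker, contraction_apply, ← Matrix.transpose_mul, Matrix.transpose_transpose,
      Matrix.adjugate_mul, Matrix.mul_adjugate, hm]
    simp
  rw [h, Submodule.mem_bot, Matrix.adjugate_fin_two, ← Matrix.ext_iff] at hadj
  simp [Fin.forall_fin_two] at hadj
  apply h0
  ext i j
  fin_cases i <;> fin_cases j <;> simp [hadj]

lemma finrank_contractionSpan_span_singleton {m : Matrix (Fin 2) (Fin 2) ℝ} (hm : m ≠ 0) :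
    finrank ℝ (contractionSpan (ℝ ∙ m)) + finrank ℝ (contraction m).ker = 3 := by
  have hle : (contraction m).ker ≤ frobForm.orthogonal (ℝ ∙ m) := by
    intro f hf e he
    obtain ⟨c, rfl⟩ := Submodule.mem_span_singleton.1 he
    have h : mᵀ * f = 0 := congrArg Prod.fst hf
    simp [frobForm_apply, h]
  rw [contractionSpan, Submodule.map₂_span_singleton_eq_map, ← LinearMap.range_domRestrict,
    ← (Submodule.submoduleOfEquivOfLe hle).finrank_eq]
  have := LinearMap.finrank_range_add_finrank_ker
    ((contraction m).domRestrict (frobForm.orthogonal (ℝ ∙ m)))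
  rwa [finrank_orthogonal_frobForm, finrank_span_singleton hm, LinearMap.ker_domRestrict] at this

lemma exists_functional_on_traceless_commutant {Y : Matrix (Fin 2) (Fin 2) ℝ}
    (hY : ∀ c : ℝ, c • (1 : Matrix (Fin 2) (Fin 2) ℝ) ≠ Y) :
    ∃ φ : Matrix (Fin 2) (Fin 2) ℝ →ₗ[ℝ] ℝ, ∀ x, Y * x = x * Y → x.trace = 0 → φ x = 0 → x = 0 := by
  have key : ∃ i j, ∀ x : Matrix (Fin 2) (Fin 2) ℝ, Y * x = x * Y → x.trace = 0 →
      x i j = 0 → x = 0 := by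
    simp only [← Matrix.ext_iff, Fin.forall_fin_two, Matrix.mul_apply, Fin.sum_univ_two,
      Matrix.trace_fin_two, Matrix.zero_apply]
    by_cases h01 : Y 0 1 = 0
    · by_cases h10 : Y 1 0 = 0
      · refine ⟨0, 0, fun x => ?_⟩
        have hne : Y 0 0 ≠ Y 1 1 := by
          intro h
          apply hY (Y 0 0)
          ext i j
          fin_cases i <;> fin_cases j <;> simp [h01, h10, h]
        grind
      · exact ⟨1, 0, fun x => by grind⟩
    · exact ⟨0, 1, fun x => by grind⟩
  obtain ⟨i, j, h⟩ := key
  exact ⟨Matrix.entryLinearMap ℝ ℝ i j, h⟩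

lemma finrank_span_pair_of_forall_smul_ne {V : Type*} [AddCommGroup V] [Module ℝ V] {x y : V}
    (hx : x ≠ 0) (hxy : ∀ a : ℝ, a • x ≠ y) : finrank ℝ (Submodule.span ℝ {x, y}) = 2 := by
  rw [← Matrix.range_cons_cons_empty x y ![],
    finrank_span_eq_card ((LinearIndependent.pair_iff' hx).2 hxy), Fintype.card_fin]

lemma finrank_contractionSpan_pair {e e' : Matrix (Fin 2) (Fin 2) ℝ} (he : e.det ≠ 0)
    (hne : ∀ a : ℝ, a • e ≠ e') :
    finrank ℝ (contractionSpan (Submodule.span ℝ {e, e'})) = 3 ∨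
      finrank ℝ (contractionSpan (Submodule.span ℝ {e, e'})) = 4 := by
  have e0 : e ≠ 0 := by rintro rfl; simp at he
  have hdim := finrank_span_pair_of_forall_smul_ne e0 hne
  have hsum := finrank_map₂_contraction_add_finrank_ker ![e, e']
    (frobForm.orthogonal (Submodule.span ℝ {e, e'}))
  rw [finrank_orthogonal_frobForm, hdim, Matrix.range_cons_cons_empty, Fintype.card_fin] at hsum
  change finrank ℝ (contractionSpan _) + _ = _ at hsum
  suffices finrank ℝ (totalContraction ![e, e']
      (frobForm.orthogonal (Submodule.span ℝ {e, e'}))).ker ≤ 1 by lia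
  have hu : IsUnit eᵀ.det := by simpa using he
  set Y := e'ᵀ * eᵀ⁻¹ with hY
  have hYe : Y * eᵀ = e'ᵀ := by rw [hY, Matrix.mul_assoc, Matrix.nonsing_inv_mul _ hu, mul_one]
  have hcomm : ∀ w ∈ (totalContraction ![e, e']
      (frobForm.orthogonal (Submodule.span ℝ {e, e'}))).ker,
      Y * (eᵀ * (w 1).1) = eᵀ * (w 1).1 * Y ∧ (eᵀ * (w 1).1).trace = 0 ∧
        ((w 1).1 = 0 → w = 0) := by
    intro w hw
    rw [LinearMap.mem_ker, totalContraction_apply, Fin.sum_univ_two] at hw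
    have h1 : eᵀ * (w 0).1 + e'ᵀ * (w 1).1 = 0 := congrArg Prod.fst hw
    have h2 : e * (w 0).1ᵀ + e' * (w 1).1ᵀ = 0 := congrArg Prod.snd hw
    have h3 : (w 0).1 * eᵀ + (w 1).1 * e'ᵀ = 0 := by
      simpa using congrArg Matrix.transpose h2
    refine ⟨?_, (w 1).2 e (Submodule.subset_span (by simp)), fun h => ?_⟩
    · have h4 : (Y * (eᵀ * (w 1).1)) * eᵀ = (eᵀ * (w 1).1 * Y) * eᵀ := by
        have h5 : eᵀ * (w 0).1 = -(e'ᵀ * (w 1).1) := eq_neg_of_add_eq_zero_left h1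
        have h6 : (w 0).1 * eᵀ = -((w 1).1 * e'ᵀ) := eq_neg_of_add_eq_zero_left h3
        rw [← Matrix.mul_assoc Y, hYe, Matrix.mul_assoc _ Y, hYe, Matrix.mul_assoc eᵀ]
        have := congrArg (· * eᵀ) h5
        simp only [Matrix.mul_assoc, h6] at this
        simpa [Matrix.mul_assoc] using this.symm
      exact ((Matrix.isUnit_iff_isUnit_det _).2 hu).mul_left_inj.1 h4
    · have h0 : (w 0).1 = 0 := by
        rw [h, mul_zero, add_zero] at h1
        exact ((Matrix.isUnit_iff_isUnit_det _).2 hu).mul_right_eq_zero.1 h1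
      ext1 k
      fin_cases k
      · exact Subtype.ext h0
      · exact Subtype.ext h
  have hscalar : ∀ c : ℝ, c • (1 : Matrix (Fin 2) (Fin 2) ℝ) ≠ Y := by
    intro c hc
    apply hne c
    rw [← hc] at hYe
    simpa using congrArg Matrix.transpose hYe
  obtain ⟨φ, hφ⟩ := exists_functional_on_traceless_commutant hscalar
  refine finrank_le_one_of_functional _ (φ ∘ₗ LinearMap.mulLeft ℝ eᵀ ∘ₗ
    (frobForm.orthogonal (Submodule.span ℝ {e, e'})).subtype ∘ₗ LinearMap.proj 1) fun w hw hw0 => ?_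
  obtain ⟨h1, h2, h3⟩ := hcomm w hw
  exact h3 (((Matrix.isUnit_iff_isUnit_det _).2 hu).mul_right_eq_zero.1 (hφ _ h1 h2 hw0))

lemma vecMul_eq_zero_or_mulVec_eq_zero {e : Matrix (Fin 2) (Fin 2) ℝ} {u z : Fin 2 → ℝ}
    (he : e.det = 0) (h : u ⬝ᵥ e *ᵥ z = 0) : u ᵥ* e = 0 ∨ e *ᵥ z = 0 := by
  simp only [dotProduct, mulVec, vecMul, Fin.sum_univ_two, funext_iff, Fin.forall_fin_two,
    Matrix.det_fin_two, Pi.zero_apply] at *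
  by_contra! hc
  grind

lemma exists_det_ne_zero_or_vecMul_eq_zero_or_mulVec_eq_zero
    (W : Submodule ℝ (Matrix (Fin 2) (Fin 2) ℝ)) :
    (∃ e ∈ W, e.det ≠ 0) ∨ (∃ u ≠ 0, ∀ e ∈ W, u ᵥ* e = 0) ∨ (∃ z ≠ 0, ∀ e ∈ W, e *ᵥ z = 0) := by
  by_contra! h
  obtain ⟨hdet, hrow, hcol⟩ := h
  obtain ⟨m, hm, hm0⟩ : ∃ m ∈ W, m ≠ 0 := by
    obtain ⟨m, hm, h⟩ := hrow ![1, 0] (by simp)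
    exact ⟨m, hm, by rintro rfl; simp at h⟩
  obtain ⟨u, hu, hum⟩ := Matrix.exists_vecMul_eq_zero_iff.2 (hdet m hm)
  obtain ⟨z, hz, hmz⟩ := Matrix.exists_mulVec_eq_zero_iff.2 (hdet m hm)
  have hdot : ∀ e ∈ W, u ⬝ᵥ e *ᵥ z = 0 := by
    intro e he
    have h1 := hdet e he
    have h2 := hdet m hm
    have h3 := hdet (m + e) (W.add_mem hm he)
    by_contra hne
    apply hm0
    ext i j
    refine (mul_eq_zero.1 (?_ : m i j * (u ⬝ᵥ e *ᵥ z) = 0)).resolve_right hne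
    simp only [dotProduct, mulVec, vecMul, Fin.sum_univ_two, funext_iff, Fin.forall_fin_two,
      Matrix.det_fin_two, Pi.zero_apply, Matrix.add_apply] at *
    fin_cases i <;> fin_cases j <;> simp only [Fin.zero_eta, Fin.mk_one] <;> grind
  obtain ⟨e, he, hue⟩ := hrow u hu
  obtain ⟨f, hf, hfz⟩ := hcol z hz
  have hez := (vecMul_eq_zero_or_mulVec_eq_zero (hdet e he) (hdot e he)).resolve_left hue
  have huf := (vecMul_eq_zero_or_mulVec_eq_zero (hdet f hf) (hdot f hf)).resolve_right hfz
  rcases vecMul_eq_zero_or_mulVec_eq_zero (hdet _ (W.add_mem he hf)) (hdot _ (W.add_mem he hf))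
    with h | h
  · rw [Matrix.vecMul_add, huf, add_zero] at h
    exact hue h
  · rw [Matrix.add_mulVec, hez, zero_add] at h
    exact hfz h

/-- Left multiplication by a row vector, as a linear map on matrices. -/
def leftVecMul (u : Fin 2 → ℝ) : Matrix (Fin 2) (Fin 2) ℝ →ₗ[ℝ] Fin 2 → ℝ where
  toFun e := u ᵥ* e
  map_add' _ _ := Matrix.vecMul_add _ _ _
  map_smul' _ _ := Matrix.vecMul_smul _ _ _

/-- The matrices annihilated by `u` from the left. -/
noncomputable def rowAnnihilator (u : Fin 2 → ℝ) : Submodule ℝ (Matrix (Fin 2) (Fin 2) ℝ) :=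
  (leftVecMul u).ker

lemma mem_rowAnnihilator (u : Fin 2 → ℝ) (e : Matrix (Fin 2) (Fin 2) ℝ) :
    e ∈ rowAnnihilator u ↔ u ᵥ* e = 0 := Iff.rfl

lemma finrank_rowAnnihilator {u : Fin 2 → ℝ} (hu : u ≠ 0) :
    finrank ℝ (rowAnnihilator u) = 2 := by
  have hsurj : (leftVecMul u).range = ⊤ := by
    rw [LinearMap.range_eq_top]
    intro y
    have huu : u ⬝ᵥ u ≠ 0 := fun h => hu (dotProduct_self_eq_zero.1 h)
    refine ⟨Matrix.vecMulVec ((u ⬝ᵥ u)⁻¹ • u) y, ?_⟩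
    change u ᵥ* Matrix.vecMulVec _ y = y
    rw [Matrix.vecMul_vecMulVec, dotProduct_smul, smul_eq_mul, inv_mul_cancel₀ huu, one_smul]
  have h := LinearMap.finrank_range_add_finrank_ker (leftVecMul u)
  rw [hsurj, finrank_top, Module.finrank_matrix, finrank_fin_fun, finrank_self,
    Fintype.card_fin] at h
  rw [rowAnnihilator]
  lia

lemma mem_S₁_iff {d : ℕ} (v : Fin 2 → Fin 2 → Fin d → ℝ) (u : Fin 2 → ℝ) :
    u ∈ S₁ v ↔ ∀ e ∈ sliceSpan v, u ᵥ* e = 0 := by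
  have h : u ∈ S₁ v ↔ ∀ j k, ∑ i, v i j k * u i = 0 := Iff.rfl
  have hs : (∀ j k, ∑ i, v i j k * u i = 0) ↔ ∀ k, u ᵥ* slice v k = 0 := by
    rw [forall_comm]
    refine forall_congr' fun k => ?_
    simp [funext_iff, vecMul, dotProduct, slice, mul_comm]
  rw [h, hs]
  constructor
  · intro h e he
    induction he using Submodule.span_induction with
    | mem x hx => obtain ⟨k, rfl⟩ := hx; exact h k
    | zero => simp
    | add x y _ _ hx hy => simp [Matrix.vecMul_add, hx, hy]
    | smul a x _ hx => simp [Matrix.vecMul_smul, hx]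
  · exact fun h k => h _ (Submodule.subset_span ⟨k, rfl⟩)

lemma mem_S₂_iff {d : ℕ} (v : Fin 2 → Fin 2 → Fin d → ℝ) (z : Fin 2 → ℝ) :
    z ∈ S₂ v ↔ ∀ e ∈ sliceSpan v, e *ᵥ z = 0 := by
  have h : z ∈ S₂ v ↔ ∀ i k, ∑ j, v i j k * z j = 0 := Iff.rfl
  have hs : (∀ i k, ∑ j, v i j k * z j = 0) ↔ ∀ k, slice v k *ᵥ z = 0 := by
    rw [forall_comm]
    refine forall_congr' fun k => ?_
    simp [funext_iff, mulVec_eq_sum, slice, mul_comm]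
  rw [h, hs]
  constructor
  · intro h e he
    induction he using Submodule.span_induction with
    | mem x hx => obtain ⟨k, rfl⟩ := hx; exact h k
    | zero => simp
    | add x y _ _ hx hy => simp [Matrix.add_mulVec, hx, hy]
    | smul a x _ hx => simp [Matrix.smul_mulVec, hx]
  · exact fun h k => h _ (Submodule.subset_span ⟨k, rfl⟩)

lemma finrank_eq_one_of_ne_bot_of_ne_top {S : Submodule ℝ (Fin 2 → ℝ)} (hbot : S ≠ ⊥)
    (htop : S ≠ ⊤) : finrank ℝ S = 1 := by
  have h1 := Submodule.one_le_finrank_iff.2 hbot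
  have h2 := Submodule.finrank_lt htop
  simp at h2
  lia

lemma sliceSpan_eq_bot_of_S₁_eq_top {d : ℕ} {v : Fin 2 → Fin 2 → Fin d → ℝ} (h : S₁ v = ⊤) :
    sliceSpan v = ⊥ := by
  rw [eq_bot_iff]
  intro e he
  rw [Submodule.mem_bot]
  refine Matrix.ext_iff_vecMul.2 fun u => ?_
  rw [(mem_S₁_iff v u).1 (by simp [h]) e he, Matrix.vecMul_zero]

lemma sliceSpan_eq_bot_of_S₂_eq_top {d : ℕ} {v : Fin 2 → Fin 2 → Fin d → ℝ} (h : S₂ v = ⊤) :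
    sliceSpan v = ⊥ := by
  rw [eq_bot_iff]
  intro e he
  rw [Submodule.mem_bot]
  refine Matrix.ext_iff_mulVec.2 fun u => ?_
  rw [(mem_S₂_iff v u).1 (by simp [h]) e he, Matrix.zero_mulVec]

lemma exists_eq_vecMulVec_of_vecMul_eq_zero {u : Fin 2 → ℝ} (hu : u ≠ 0)
    {e : Matrix (Fin 2) (Fin 2) ℝ} (he : u ᵥ* e = 0) :
    ∃ b, e = Matrix.vecMulVec ![-u 1, u 0] b := by
  have huu : u 0 * u 0 + u 1 * u 1 ≠ 0 := by
    intro h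
    exact hu (dotProduct_self_eq_zero.1 (by simpa [dotProduct, Fin.sum_univ_two] using h))
  refine ⟨fun j => (u 0 * e 1 j - u 1 * e 0 j) / (u 0 * u 0 + u 1 * u 1), ?_⟩
  ext i j
  have h : u 0 * e 0 j + u 1 * e 1 j = 0 := by
    simpa [vecMul, dotProduct, Fin.sum_univ_two] using congrFun he j
  fin_cases i
  · simp only [Fin.zero_eta, Matrix.vecMulVec_apply, Matrix.cons_val_zero]
    rw [mul_div_assoc', eq_div_iff huu]
    linear_combination u 0 * h
  · simp only [Fin.mk_one, Matrix.vecMulVec_apply, Matrix.cons_val_one, Matrix.cons_val_fin_one]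
    rw [mul_div_assoc', eq_div_iff huu]
    linear_combination u 1 * h

lemma finrank_contractionSpan_rowAnnihilator {u : Fin 2 → ℝ} (hu : u ≠ 0) :
    finrank ℝ (contractionSpan (rowAnnihilator u)) = 1 := by
  set a : Fin 2 → ℝ := ![-u 1, u 0] with ha
  have hua : u ⬝ᵥ a = 0 := by simp [ha, dotProduct, Fin.sum_univ_two]; ring
  have ha0 : a ≠ 0 := by
    intro h
    apply hu
    have h0 := congrFun h 0
    have h1 := congrFun h 1
    ext i
    fin_cases i <;> simp_all
  have hmem : ∀ b, Matrix.vecMulVec a b ∈ rowAnnihilator u := by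
    intro b
    rw [mem_rowAnnihilator, Matrix.vecMul_vecMulVec, hua, zero_smul]
  have hfrob : ∀ b f, frobForm (Matrix.vecMulVec a b) f = b ⬝ᵥ a ᵥ* f := by
    intro b f
    rw [frobForm_apply, Matrix.transpose_vecMulVec, Matrix.vecMulVec_mul, Matrix.trace_vecMulVec]
  have hF : ∀ f, f ∈ frobForm.orthogonal (rowAnnihilator u) ↔ ∃ c, f = Matrix.vecMulVec u c := by
    intro f
    constructor
    · intro hf
      have haf : a ᵥ* f = 0 := by
        refine dotProduct_self_eq_zero.1 ?_
        rw [← hfrob]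
        exact hf _ (hmem _)
      obtain ⟨c, rfl⟩ := exists_eq_vecMulVec_of_vecMul_eq_zero ha0 haf
      refine ⟨-c, ?_⟩
      ext i j
      fin_cases i <;> simp [ha, Matrix.vecMulVec_apply]
    · rintro ⟨c, rfl⟩ e he
      obtain ⟨b, rfl⟩ := exists_eq_vecMulVec_of_vecMul_eq_zero hu he
      rw [hfrob, Matrix.vecMul_vecMulVec, dotProduct_comm a, hua, zero_smul, dotProduct_zero]
  have hne : Matrix.vecMulVec a u ≠ 0 := by
    simp [Matrix.vecMulVec_eq_zero, ha0, hu]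
  suffices contractionSpan (rowAnnihilator u) = ℝ ∙ ((0, Matrix.vecMulVec a u) :
      Matrix (Fin 2) (Fin 2) ℝ × Matrix (Fin 2) (Fin 2) ℝ) by
    rw [this, finrank_span_singleton]
    simpa using hne
  apply le_antisymm
  · rw [contractionSpan, Submodule.map₂_le]
    intro e he f hf
    obtain ⟨b, rfl⟩ := exists_eq_vecMulVec_of_vecMul_eq_zero hu he
    obtain ⟨c, rfl⟩ := (hF f).1 hf
    refine Submodule.mem_span_singleton.2 ⟨b ⬝ᵥ c, ?_⟩
    rw [contraction_apply, Matrix.transpose_vecMulVec, Matrix.transpose_vecMulVec,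
      Matrix.vecMulVec_mul_vecMulVec, Matrix.vecMulVec_mul_vecMulVec, dotProduct_comm a, hua]
    simp only [Prod.smul_mk, smul_zero, zero_smul, Matrix.vecMulVec_smul, Matrix.vecMulVec_zero]
    rfl
  · rw [Submodule.span_singleton_le_iff_mem]
    have h := Submodule.apply_mem_map₂ contraction (hmem ![1, 0]) ((hF _).2 ⟨![1, 0], rfl⟩)
    rw [contraction_apply, Matrix.transpose_vecMulVec, Matrix.transpose_vecMulVec,
      Matrix.vecMulVec_mul_vecMulVec, Matrix.vecMulVec_mul_vecMulVec, dotProduct_comm a, hua] at h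
    simpa [contractionSpan] using h

/-- Exchange of the first two indices. -/
def swapFirst {d : ℕ} (v : Fin 2 → Fin 2 → Fin d → ℝ) : Fin 2 → Fin 2 → Fin d → ℝ :=
  fun i j k => v j i k

lemma n₁_swapFirst {d : ℕ} (v : Fin 2 → Fin 2 → Fin d → ℝ) : n₁ (swapFirst v) = n₂ v := rfl

lemma n₂_swapFirst {d : ℕ} (v : Fin 2 → Fin 2 → Fin d → ℝ) : n₂ (swapFirst v) = n₁ v := rfl

lemma n₃_swapFirst {d : ℕ} (v : Fin 2 → Fin 2 → Fin d → ℝ) : n₃ (swapFirst v) = n₃ v := by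
  have h : S₃ (swapFirst v) = S₃ v := by
    ext w
    exact forall_comm
  rw [n₃, n₃, h]

lemma swapFirst_mem_S₄ {d : ℕ} {v w : Fin 2 → Fin 2 → Fin d → ℝ} (h : w ∈ S₄ v) :
    swapFirst w ∈ S₄ (swapFirst v) := by
  obtain ⟨h1, h2, h3⟩ := h
  refine ⟨fun k l => ?_, h3, h2⟩
  rw [Finset.sum_comm]
  exact h1 k l

/-- Exchange of the first two indices identifies `S₄ v` with `S₄ (swapFirst v)`. -/
def S₄SwapEquiv {d : ℕ} (v : Fin 2 → Fin 2 → Fin d → ℝ) : S₄ (swapFirst v) ≃ₗ[ℝ] S₄ v where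
  toFun w := ⟨swapFirst w.1, swapFirst_mem_S₄ w.2⟩
  invFun w := ⟨swapFirst w.1, swapFirst_mem_S₄ w.2⟩
  map_add' _ _ := rfl
  map_smul' _ _ := rfl

lemma n₄_swapFirst {d : ℕ} (v : Fin 2 → Fin 2 → Fin d → ℝ) : n₄ (swapFirst v) = n₄ v :=
  (S₄SwapEquiv v).finrank_eq

lemma invariants_of_det_ne_zero {d : ℕ} (hd : 4 ≤ d) (v : Fin 2 → Fin 2 → Fin d → ℝ)
    {e : Matrix (Fin 2) (Fin 2) ℝ} (he : e ∈ sliceSpan v) (hdet : e.det ≠ 0) :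
    n₁ v = 0 ∧ n₂ v = 0 ∧
      ((n₃ v = d - 1 ∧ n₄ v = 3 * d - 3) ∨ (n₃ v = d - 2 ∧ n₄ v = 2 * d - 3) ∨
        (n₃ v = d - 2 ∧ n₄ v = 2 * d - 4) ∨ (n₃ v = d - 3 ∧ n₄ v = d - 2) ∨
        (n₃ v = d - 3 ∧ n₄ v = d - 3) ∨ (n₃ v = d - 4 ∧ n₄ v = 0)) := by
  have he0 : e ≠ 0 := by rintro rfl; simp at hdet
  refine ⟨?_, ?_, ?_⟩
  · rw [n₁, Submodule.finrank_eq_zero, eq_bot_iff]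
    intro u hu
    exact Matrix.eq_zero_of_vecMul_eq_zero hdet ((mem_S₁_iff v u).1 hu e he)
  · rw [n₂, Submodule.finrank_eq_zero, eq_bot_iff]
    intro z hz
    exact Matrix.eq_zero_of_mulVec_eq_zero hdet ((mem_S₂_iff v z).1 hz e he)
  have h3 := finrank_sliceSpan_add_n₃ v
  have h4 := finrank_contractionSpan_add_n₄ v
  have hle : (ℝ ∙ e) ≤ sliceSpan v := (Submodule.span_singleton_le_iff_mem _ _).2 he
  have hr1 := Submodule.finrank_mono hle
  rw [finrank_span_singleton he0] at hr1
  have hr4 := Submodule.finrank_le (sliceSpan v)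
  simp only [Module.finrank_matrix, finrank_self, Fintype.card_fin] at hr4
  obtain hr | hr | hr | hr : finrank ℝ (sliceSpan v) = 1 ∨ finrank ℝ (sliceSpan v) = 2 ∨
    finrank ℝ (sliceSpan v) = 3 ∨ finrank ℝ (sliceSpan v) = 4 := by lia
  · have hW : (ℝ ∙ e) = sliceSpan v :=
      Submodule.eq_of_le_of_finrank_eq hle (by rw [hr, finrank_span_singleton he0])
    have hc := finrank_contractionSpan_span_singleton he0
    rw [ker_contraction_eq_bot hdet, finrank_bot, hW] at hc
    rw [hr] at h3 h4
    lia
  · obtain ⟨e', he', hne⟩ : ∃ e' ∈ sliceSpan v, e' ∉ ℝ ∙ e := by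
      by_contra! h
      have := Submodule.finrank_mono (show sliceSpan v ≤ ℝ ∙ e from h)
      rw [finrank_span_singleton he0] at this
      lia
    have hne' : ∀ a : ℝ, a • e ≠ e' := fun a h => hne (Submodule.mem_span_singleton.2 ⟨a, h⟩)
    have hW : Submodule.span ℝ {e, e'} = sliceSpan v := by
      refine Submodule.eq_of_le_of_finrank_eq (Submodule.span_le.2 ?_) ?_
      · rintro x (rfl | rfl) <;> assumption
      · rw [hr, finrank_span_pair_of_forall_smul_ne he0 hne']
    have hc := finrank_contractionSpan_pair hdet hne'
    rw [hW] at hc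
    rw [hr] at h3 h4
    lia
  · have hortho := finrank_orthogonal_frobForm (sliceSpan v)
    rw [hr] at hortho
    obtain ⟨⟨m, hm⟩, hm0, -⟩ := finrank_eq_one_iff'.1 hortho
    have hm0' : m ≠ 0 := fun h => hm0 (Subtype.ext h)
    have hW : (ℝ ∙ m) = frobForm.orthogonal (sliceSpan v) :=
      Submodule.eq_of_le_of_finrank_eq ((Submodule.span_singleton_le_iff_mem _ _).2 hm)
        (by rw [hortho, finrank_span_singleton hm0'])
    have hc := finrank_contractionSpan_span_singleton hm0'
    rw [hW, finrank_contractionSpan_orthogonal] at hc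
    have hk := finrank_ker_contraction_le_one hm0'
    rw [hr] at h3 h4
    lia
  · rw [hr] at h3 h4
    lia

lemma invariants_of_vecMul_eq_zero {d : ℕ} (v : Fin 2 → Fin 2 → Fin d → ℝ)
    {u : Fin 2 → ℝ} (hu : u ≠ 0) (hW : ∀ e ∈ sliceSpan v, u ᵥ* e = 0) :
    (n₁ v = 2 ∧ n₂ v = 2 ∧ n₃ v = d ∧ n₄ v = 4 * d) ∨
      (n₁ v = 1 ∧ n₂ v = 1 ∧ n₃ v = d - 1 ∧ n₄ v = 3 * d - 2) ∨
      (n₁ v = 1 ∧ n₂ v = 0 ∧ n₃ v = d - 2 ∧ n₄ v = 2 * d - 1) := by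
  have h3 := finrank_sliceSpan_add_n₃ v
  have h4 := finrank_contractionSpan_add_n₄ v
  have hle : sliceSpan v ≤ rowAnnihilator u := hW
  have hr2 := Submodule.finrank_mono hle
  rw [finrank_rowAnnihilator hu] at hr2
  obtain hr | hr0 := Nat.eq_zero_or_pos (finrank ℝ (sliceSpan v))
  · have hbot := Submodule.finrank_eq_zero.1 hr
    have h1 : S₁ v = ⊤ := by
      rw [eq_top_iff]
      intro u _
      simp [mem_S₁_iff, hbot]
    have h2 : S₂ v = ⊤ := by
      rw [eq_top_iff]
      intro u _
      simp [mem_S₂_iff, hbot]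
    rw [hr] at h3 h4
    rw [hbot, contractionSpan, Submodule.map₂_bot_left, finrank_bot] at h4
    refine Or.inl ⟨?_, ?_, by lia, by lia⟩
    · rw [n₁, h1]; simp
    · rw [n₂, h2]; simp
  have hbot : sliceSpan v ≠ ⊥ := fun h => hr0.ne' (Submodule.finrank_eq_zero.2 h)
  have hn₁ : n₁ v = 1 := finrank_eq_one_of_ne_bot_of_ne_top
    ((Submodule.ne_bot_iff _).2 ⟨u, (mem_S₁_iff v u).2 hW, hu⟩)
    fun h => hbot (sliceSpan_eq_bot_of_S₁_eq_top h)
  obtain hr | hr : finrank ℝ (sliceSpan v) = 1 ∨ finrank ℝ (sliceSpan v) = 2 := by lia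
  · obtain ⟨⟨m, hm⟩, hm0, -⟩ := finrank_eq_one_iff'.1 hr
    have hm0' : m ≠ 0 := fun h => hm0 (Subtype.ext h)
    have hspan : (ℝ ∙ m) = sliceSpan v :=
      Submodule.eq_of_le_of_finrank_eq ((Submodule.span_singleton_le_iff_mem _ _).2 hm)
        (by rw [hr, finrank_span_singleton hm0'])
    have hdet : m.det = 0 := Matrix.exists_vecMul_eq_zero_iff.1 ⟨u, hu, hW m hm⟩
    obtain ⟨z, hz, hmz⟩ := Matrix.exists_mulVec_eq_zero_iff.2 hdet
    have hn₂ : n₂ v = 1 := by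
      refine finrank_eq_one_of_ne_bot_of_ne_top ((Submodule.ne_bot_iff _).2 ⟨z, ?_, hz⟩)
        fun h => hbot (sliceSpan_eq_bot_of_S₂_eq_top h)
      rw [mem_S₂_iff, ← hspan]
      intro e he
      obtain ⟨c, rfl⟩ := Submodule.mem_span_singleton.1 he
      rw [Matrix.smul_mulVec, hmz, smul_zero]
    have hc := finrank_contractionSpan_span_singleton hm0'
    have hk := finrank_ker_contraction_le_one hm0'
    have hk' := Submodule.one_le_finrank_iff.2 (ker_contraction_ne_bot hm0' hdet)
    rw [hspan] at hc
    rw [hr] at h3 h4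
    lia
  · have hspan : sliceSpan v = rowAnnihilator u :=
      Submodule.eq_of_le_of_finrank_eq hle (by rw [hr, finrank_rowAnnihilator hu])
    have hn₂ : n₂ v = 0 := by
      rw [n₂, Submodule.finrank_eq_zero, eq_bot_iff]
      intro z hz
      rw [mem_S₂_iff, hspan] at hz
      have h := hz (Matrix.vecMulVec ![-u 1, u 0] z) (by
        rw [mem_rowAnnihilator, Matrix.vecMul_vecMulVec]
        simp [dotProduct, Fin.sum_univ_two, mul_comm])
      rw [Matrix.vecMulVec_mulVec] at h
      by_contra hz0
      have hzz : z ⬝ᵥ z ≠ 0 := fun h => hz0 (dotProduct_self_eq_zero.1 h)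
      apply hu
      have h0 := congrFun h 0
      have h1 := congrFun h 1
      ext i
      fin_cases i <;> simp_all
    have hc := finrank_contractionSpan_rowAnnihilator hu
    rw [← hspan] at hc
    rw [hr] at h3 h4
    lia

/-- **Completeness of the `(2, 2, d)` classification for `d ≥ 4`.**
For every tripartite state `v` of dimensions `(2, 2, d)` with `d ≥ 4`,
the invariant tuple `(n₁ v, n₂ v, n₃ v, ñ₄ v)` takes one of exactly ten
values: there are exactly 10 entanglement classes. -/
theorem invariant_values_22d (d : ℕ) (hd : 4 ≤ d)
    (v : Fin 2 → Fin 2 → Fin d → ℝ) :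
    (n₁ v, n₂ v, n₃ v, n₄ v) ∈
      ({(2, 2, d, 4 * d),
        (1, 1, d - 1, 3 * d - 2),
        (0, 0, d - 1, 3 * d - 3),
        (0, 1, d - 2, 2 * d - 1),
        (1, 0, d - 2, 2 * d - 1),
        (0, 0, d - 2, 2 * d - 3),
        (0, 0, d - 2, 2 * d - 4),
        (0, 0, d - 3, d - 2),
        (0, 0, d - 3, d - 3),
        (0, 0, d - 4, 0)} : Set (ℕ × ℕ × ℕ × ℕ)) := by
  simp only [Set.mem_insert_iff, Set.mem_singleton_iff, Prod.mk.injEq]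
  rcases exists_det_ne_zero_or_vecMul_eq_zero_or_mulVec_eq_zero (sliceSpan v) with
    ⟨e, he, hdet⟩ | ⟨u, hu, hW⟩ | ⟨z, hz, hW⟩
  · obtain ⟨h1, h2, h⟩ := invariants_of_det_ne_zero hd v he hdet
    rcases h with ⟨h3, h4⟩ | ⟨h3, h4⟩ | ⟨h3, h4⟩ | ⟨h3, h4⟩ | ⟨h3, h4⟩ | ⟨h3, h4⟩ <;>
      simp [h1, h2, h3, h4]
  · rcases invariants_of_vecMul_eq_zero v hu hW with
      ⟨h1, h2, h3, h4⟩ | ⟨h1, h2, h3, h4⟩ | ⟨h1, h2, h3, h4⟩ <;>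
      simp [h1, h2, h3, h4]
  · have h := invariants_of_vecMul_eq_zero (swapFirst v) hz
      ((mem_S₁_iff (swapFirst v) z).1 ((mem_S₂_iff v z).2 hW))
    rw [n₁_swapFirst, n₂_swapFirst, n₃_swapFirst, n₄_swapFirst] at h
    rcases h with ⟨h2, h1, h3, h4⟩ | ⟨h2, h1, h3, h4⟩ | ⟨h2, h1, h3, h4⟩ <;>
      simp [h1, h2, h3, h4]
end

section
/- For every four-qubit array v : Fin 2 → Fin 2 → Fin 2 → Fin 2 → ℝ (writing v_{abcd} for v a b c d), the three 4×4 determinants h₂ = det [[v₁₁₁₁, v₁₂₁₁, v₂₁₁₁, v₂₂₁₁], [v₁₁₁₂, v₁₂₁₂, v₂₁₁₂, v₂₂₁₂], [v₁₁₂₁, v₁₂₂₁, v₂₁₂₁, v₂₂₂₁], [v₁₁₂₂, v₁₂₂₂, v₂₁₂₂, v₂₂₂₂]], h₃ = det [[v₁₁₁₁, v₂₁₁₁, v₁₁₂₁, v₂₁₂₁], [v₁₁₁₂, v₂₁₁₂, v₁₁₂₂, v₂₁₂₂], [v₁₂₁₁, v₂₂₁₁, v₁₂₂₁, v₂₂₂₁],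 [v₁₂₁₂, v₂₂₁₂, v₁₂₂₂, v₂₂₂₂]], and h₄ = det [[v₁₁₁₁, v₁₁₁₂, v₂₁₁₁, v₂₁₁₂], [v₁₁₂₁, v₁₁₂₂, v₂₁₂₁, v₂₁₂₂], [v₁₂₁₁, v₁₂₁₂, v₂₂₁₁, v₂₂₁₂], [v₁₂₂₁, v₁₂₂₂, v₂₂₂₁, v₂₂₂₂]] satisfy the identity h₂ + h₃ + h₄ = 0. -/
/-- **The classical four-qubit invariants `h₂, h₃, h₄` sum to zero.**
The three `4×4` flattening determinants of a four-qubit coordinate array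
`v : Fin 2 → Fin 2 → Fin 2 → Fin 2 → ℝ` satisfy `h₂ + h₃ + h₄ = 0`.
(Indices `1, 2` of the paper correspond to `0, 1 : Fin 2`.) -/
theorem four_qubit_det_sum_eq_zero (v : Fin 2 → Fin 2 → Fin 2 → Fin 2 → ℝ) :
    Matrix.det !![v 0 0 0 0, v 0 1 0 0, v 1 0 0 0, v 1 1 0 0;
                  v 0 0 0 1, v 0 1 0 1, v 1 0 0 1, v 1 1 0 1;
                  v 0 0 1 0, v 0 1 1 0, v 1 0 1 0, v 1 1 1 0;
                  v 0 0 1 1, v 0 1 1 1, v 1 0 1 1, v 1 1 1 1] +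
    Matrix.det !![v 0 0 0 0, v 1 0 0 0, v 0 0 1 0, v 1 0 1 0;
                  v 0 0 0 1, v 1 0 0 1, v 0 0 1 1, v 1 0 1 1;
                  v 0 1 0 0, v 1 1 0 0, v 0 1 1 0, v 1 1 1 0;
                  v 0 1 0 1, v 1 1 0 1, v 0 1 1 1, v 1 1 1 1] +
    Matrix.det !![v 0 0 0 0, v 0 0 0 1, v 1 0 0 0, v 1 0 0 1;
                  v 0 0 1 0, v 0 0 1 1, v 1 0 1 0, v 1 0 1 1;
                  v 0 1 0 0, v 0 1 0 1, v 1 1 0 0, v 1 1 0 1;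
                  v 0 1 1 0, v 0 1 1 1, v 1 1 1 0, v 1 1 1 1] = 0 := by
  simp [Matrix.det_succ_row_zero, Fin.sum_univ_succ, Fin.succAbove]
  ring
end
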